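/- Let m be an odd positive integer such that q = 2m² + 2m + 1 is a prime power. Let χ₄ be a multiplicative character of F_{q²} with χ₄(ω) = i, and suppose ε, δ ∈ {1, −1} satisfy G_q(η)·G_{q²}(χ₄)/q = εm + δ(m+1)·i in ℂ. Let h ∈ {0,1,2,3} and let ℓ be an integer with χ₄(ω^ℓ) = i^{3+h} and χ₄(ω^{ℓq} − ω^ℓ) = i^{δ(1+2h)}. Set (H₀, H₁) := ({h, h+1}, {h+1, h+2}) if εδ = 1 and (H₀, H₁) := ({h+1, h+2}, {h, h+1}) if εδ = −1, with elements reduced modulo 4, and for d = 0, 1 define D_d := {x ∈ F_q : 1 + x·ω^ℓ ∈ ⋃_{j∈H_d} C_j^{(4,q²)}}. Then |D₀| = m², |D₁| = m² + m, { |D₀ ∩ ((C_0^{(2,q)}∪{0}) + s)| + |D₁ ∩ (C_0^{(2,q)} + s)| : s ∈ F_q } = {m², m²+m+1}, and { |D₀ ∩ (C_0^{(2,q)} + s)| + |D₁ ∩ ((F_q∖(C_0^{(2,q)}∪{0})) + s)| : s ∈ F_q } = {m²−1, m², m²+m−1, m²+m}. -/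

import Mathlib

noncomputable section

open Complex

open scoped Classical

open Classical in
/-- The quadratic character of a finite field, with values in `ℂ`. -/
noncomputable def quadChar (F : Type*) [Field F] : F → ℂ :=
  fun x => if x = 0 then 0 else if IsSquare x then 1 else -1

/-- The `i`-th cyclotomic class `C_i^{(e,q²)} = ω^i ⟨ω^e⟩` of order `e`. -/
def cyc {F2 : Type*} [Field F2] (ω : F2ˣ) (e : ℕ) (i : ℤ) : Set F2 :=
  {x | ∃ k : ℤ, x = ((ω ^ (i + (e : ℤ) * k) : F2ˣ) : F2)}


lemma final_comb (F : Type) [Field F] [Fintype F] (m : ℕ) (hm : 0 < m)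
    (P r : F → ℤ)
    (hPr : ∀ x, (P x = 1 ∧ r x = 0) ∨ (P x = 0 ∧ r x = 1) ∨ (P x = -1 ∧ r x = 0) ∨
      (P x = 0 ∧ r x = -1))
    (hcard : Fintype.card F = 2 * m ^ 2 + 2 * m + 1) (hF : ringChar F ≠ 2)
    (hP : ∑ x, P x = -m) (hr : ∑ x, r x = -(m + 1))
    (hsq : ∑ x, (P x ^ 2 - r x ^ 2) = 1)
    (hηP : ∀ s, ∑ x, quadraticChar F (x - s) * P x = m * r s - (m + 1) * P s)
    (hηr : ∀ s, ∑ x, quadraticChar F (x - s) * r x = 1 + m * P s + (m + 1) * r s)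
    (C₀ : Set F) (hC₀ : C₀ = {x : F | x ≠ 0 ∧ IsSquare x})
    (D₀ D₁ : Set F) (hD₀ : ∀ x, x ∈ D₀ ↔ P x + r x = 1) (hD₁ : ∀ x, x ∈ D₁ ↔ r x - P x = 1) :
    D₀.ncard = m ^ 2 ∧ D₁.ncard = m ^ 2 + m ∧
      (Set.range fun s : F =>
          (D₀ ∩ ((fun x => x + s) '' (C₀ ∪ {0}))).ncard +
            (D₁ ∩ ((fun x => x + s) '' C₀)).ncard) =
        ({m ^ 2, m ^ 2 + m + 1} : Set ℕ) ∧
      (Set.range fun s : F =>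
          (D₀ ∩ ((fun x => x + s) '' C₀)).ncard +
            (D₁ ∩ ((fun x => x + s) '' (Set.univ \ (C₀ ∪ {0})))).ncard) =
        ({m ^ 2 - 1, m ^ 2, m ^ 2 + m - 1, m ^ 2 + m} : Set ℕ) := by
  have hnc : ∀ S : Set F, (S.ncard : ℤ) = ∑ x, if x ∈ S then 1 else 0 := by
    intro S
    rw [Set.ncard_eq_toFinset_card', Finset.sum_boole]
    congr 2
    ext x; simp
  have him : ∀ (s x : F) (S : Set F), x ∈ (fun x => x + s) '' S ↔ x - s ∈ S := by
    intro s x S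
    constructor
    · rintro ⟨y, hy, rfl⟩; simpa using hy
    · intro h; exact ⟨x - s, h, by simp⟩
  have hcardZ : ∑ x : F, (1 : ℤ) = 2 * m ^ 2 + 2 * m + 1 := by
    simp [hcard]
  have hη0 : ∀ s : F, ∑ x, quadraticChar F (x - s) = 0 := by
    intro s
    rw [← quadraticChar_sum_zero hF]
    exact Fintype.sum_equiv (Equiv.subRight s) _ _ (fun x => rfl)
  have hind0 : ∀ x, 2 * (if x ∈ D₀ then (1 : ℤ) else 0) = 1 + P x + r x := by
    intro x; rw [hD₀]; rcases hPr x with h | h | h | h <;> simp [h]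
  have hind1 : ∀ x, 2 * (if x ∈ D₁ then (1 : ℤ) else 0) = 1 - P x + r x := by
    intro x; rw [hD₁]; rcases hPr x with h | h | h | h <;> simp [h]
  have hc0 : (D₀.ncard : ℤ) = m ^ 2 := by
    have : 2 * (D₀.ncard : ℤ) = 2 * m ^ 2 := by
      rw [hnc, Finset.mul_sum, Finset.sum_congr rfl (fun x _ => hind0 x),
        Finset.sum_add_distrib, Finset.sum_add_distrib, hP, hr, hcardZ]
      ring
    linarith
  have hc1 : (D₁.ncard : ℤ) = m ^ 2 + m := by
    have : 2 * (D₁.ncard : ℤ) = 2 * (m ^ 2 + m) := by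
      rw [hnc, Finset.mul_sum, Finset.sum_congr rfl (fun x _ => hind1 x),
        Finset.sum_add_distrib, Finset.sum_sub_distrib, hP, hr, hcardZ]
      ring
    linarith
  -- quadratic character indicator
  have hq : ∀ y : F, (y = 0 ∧ quadraticChar F y = 0 ∧ y ∉ C₀) ∨
      (y ≠ 0 ∧ quadraticChar F y = 1 ∧ y ∈ C₀) ∨
      (y ≠ 0 ∧ quadraticChar F y = -1 ∧ y ∉ C₀) := by
    intro y
    subst hC₀
    by_cases hy : y = 0
    · left; simp [hy]
    · by_cases hs : IsSquare y
      · right; left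
        exact ⟨hy, (quadraticChar_one_iff_isSquare hy).2 hs, hy, hs⟩
      · right; right
        exact ⟨hy, quadraticChar_neg_one_iff_not_isSquare.2 hs, fun h => hs h.2⟩
  have key1 : ∀ s x, 4 * ((if x ∈ D₀ ∩ ((fun x => x + s) '' (C₀ ∪ {0})) then (1 : ℤ) else 0) +
      (if x ∈ D₁ ∩ ((fun x => x + s) '' C₀) then (1 : ℤ) else 0)) =
      2 * 1 + 2 * r x + 2 * quadraticChar F (x - s) + 2 * (quadraticChar F (x - s) * r x)
        + (if x = s then 2 * P x else 0) := by
    intro s x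
    have h0 := hind0 x
    have h1 := hind1 x
    simp only [Set.mem_inter_iff, him, Set.mem_union, Set.mem_singleton_iff]
    have e : x = s ↔ x - s = 0 := sub_eq_zero.symm
    rw [e]
    rcases hq (x - s) with ⟨a, b, c⟩ | ⟨a, b, c⟩ | ⟨a, b, c⟩ <;> (try rw [a] at b c) <;>
      simp only [a, b, c, or_true, or_false, and_true, and_false, if_true, if_false] <;> linarith
  have key2 : ∀ s x, 4 * ((if x ∈ D₀ ∩ ((fun x => x + s) '' C₀) then (1 : ℤ) else 0) +
      (if x ∈ D₁ ∩ ((fun x => x + s) '' (Set.univ \ (C₀ ∪ {0}))) then (1 : ℤ) else 0)) =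
      2 * 1 + 2 * r x + 2 * (quadraticChar F (x - s) * P x)
        - (if x = s then 2 + 2 * r x else 0) := by
    intro s x
    have h0 := hind0 x
    have h1 := hind1 x
    simp only [Set.mem_inter_iff, him, Set.mem_union, Set.mem_singleton_iff, Set.mem_sdiff,
      Set.mem_univ, true_and]
    have e : x = s ↔ x - s = 0 := sub_eq_zero.symm
    rw [e]
    rcases hq (x - s) with ⟨a, b, c⟩ | ⟨a, b, c⟩ | ⟨a, b, c⟩ <;> (try rw [a] at b c) <;>
      simp only [a, b, c, or_true, or_false, and_true, and_false, if_true, if_false,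
        not_true, not_false_iff] <;> linarith
  have val1 : ∀ s, 2 * (((D₀ ∩ ((fun x => x + s) '' (C₀ ∪ {0}))).ncard +
            (D₁ ∩ ((fun x => x + s) '' C₀)).ncard : ℕ) : ℤ) =
      2 * m ^ 2 + m + 1 + (m + 1) * P s + (m + 1) * r s := by
    intro s
    have : 4 * (((D₀ ∩ ((fun x => x + s) '' (C₀ ∪ {0}))).ncard +
            (D₁ ∩ ((fun x => x + s) '' C₀)).ncard : ℕ) : ℤ) =
      2 * (2 * m ^ 2 + m + 1 + (m + 1) * P s + (m + 1) * r s) := by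
      push_cast
      rw [hnc, hnc, ← Finset.sum_add_distrib, Finset.mul_sum]
      refine (Finset.sum_congr rfl fun x _ => (by convert key1 s x)).trans ?_
      simp only [Finset.sum_add_distrib, ← Finset.mul_sum, hr, hη0, hηr, hcardZ]
      simp
      ring
    linarith
  have val2 : ∀ s, 2 * (((D₀ ∩ ((fun x => x + s) '' C₀)).ncard +
            (D₁ ∩ ((fun x => x + s) '' (Set.univ \ (C₀ ∪ {0})))).ncard : ℕ) : ℤ) =
      2 * m ^ 2 + m - 1 + (m - 1) * r s - (m + 1) * P s := by
    intro s
    have : 4 * (((D₀ ∩ ((fun x => x + s) '' C₀)).ncard +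
            (D₁ ∩ ((fun x => x + s) '' (Set.univ \ (C₀ ∪ {0})))).ncard : ℕ) : ℤ) =
      2 * (2 * m ^ 2 + m - 1 + (m - 1) * r s - (m + 1) * P s) := by
      push_cast
      rw [hnc, hnc, ← Finset.sum_add_distrib, Finset.mul_sum]
      refine (Finset.sum_congr rfl fun x _ => (by convert key2 s x)).trans ?_
      simp only [Finset.sum_add_distrib, Finset.sum_sub_distrib, ← Finset.mul_sum, hr, hη0, hηP,
        hcardZ]
      simp
      ring
    linarith
  -- existence of the four kinds of points
  have hPsum : ∀ a b c d : ℤ, ∑ x, (a * 1 + b * P x + c * r x + d * (P x ^ 2 - r x ^ 2)) =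
      a * (2 * m ^ 2 + 2 * m + 1) - b * m - c * (m + 1) + d := by
    intro a b c d
    simp only [Finset.sum_add_distrib, ← Finset.mul_sum, hP, hr, hsq, hcardZ]
    ring
  have hmZ : (1 : ℤ) ≤ m := by exact_mod_cast hm
  have ex1 : ∃ x, P x = 1 ∧ r x = 0 := by
    by_contra! hcon
    have := hPsum 1 2 0 1
    rw [Finset.sum_eq_zero] at this
    · nlinarith
    · intro x _
      rcases hPr x with h | h | h | h
      · exact absurd h.2 (hcon x h.1)
      all_goals simp [h]
  have ex2 : ∃ x, P x = -1 ∧ r x = 0 := by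
    by_contra! hcon
    have := hPsum 1 (-2) 0 1
    rw [Finset.sum_eq_zero] at this
    · nlinarith
    · intro x _
      rcases hPr x with h | h | h | h
      rotate_left 2
      · exact absurd h.2 (hcon x h.1)
      all_goals simp [h]
  have ex3 : ∃ x, P x = 0 ∧ r x = -1 := by
    by_contra! hcon
    have := hPsum 1 0 (-2) (-1)
    rw [Finset.sum_eq_zero] at this
    · nlinarith
    · intro x _
      rcases hPr x with h | h | h | h
      rotate_left 3
      · exact absurd h.2 (hcon x h.1)
      all_goals simp [h]
  have ex4 : m ≠ 1 → ∃ x, P x = 0 ∧ r x = 1 := by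
    intro hm1
    by_contra! hcon
    have := hPsum 1 0 2 (-1)
    have h2 : (2 : ℤ) ≤ m := by exact_mod_cast (by omega : 2 ≤ m)
    rw [Finset.sum_eq_zero] at this
    · nlinarith
    · intro x _
      rcases hPr x with h | h | h | h
      rotate_left 1
      · exact absurd h.2 (hcon x h.1)
      all_goals simp [h]
  have hm2 : 1 ≤ m ^ 2 := Nat.one_le_pow _ _ hm
  refine ⟨by exact_mod_cast hc0, by exact_mod_cast hc1, ?_, ?_⟩
  · ext n
    simp only [Set.mem_range, Set.mem_insert_iff, Set.mem_singleton_iff]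
    constructor
    · rintro ⟨s, rfl⟩
      have := val1 s
      rcases hPr s with ⟨h, h'⟩ | ⟨h, h'⟩ | ⟨h, h'⟩ | ⟨h, h'⟩ <;> rw [h, h'] at this
      · right; zify; push_cast at this; linarith
      · right; zify; push_cast at this; linarith
      · left; zify; push_cast at this; linarith
      · left; zify; push_cast at this; linarith
    · rintro (rfl | rfl)
      · obtain ⟨s, h, h'⟩ := ex2
        refine ⟨s, ?_⟩
        have := val1 s
        rw [h, h'] at this
        zify; push_cast at this; linarith
      · obtain ⟨s, h, h'⟩ := ex1
        refine ⟨s, ?_⟩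
        have := val1 s
        rw [h, h'] at this
        zify; push_cast at this; linarith
  · have tr1 : ∀ s, P s = 1 ∧ r s = 0 → (D₀ ∩ ((fun x => x + s) '' C₀)).ncard +
            (D₁ ∩ ((fun x => x + s) '' (Set.univ \ (C₀ ∪ {0})))).ncard = m ^ 2 - 1 := by
      rintro s ⟨h, h'⟩
      have := val2 s
      rw [h, h'] at this
      zify [hm2]; push_cast at this; linarith
    have tr2 : ∀ s, P s = 0 ∧ r s = 1 → (D₀ ∩ ((fun x => x + s) '' C₀)).ncard +
            (D₁ ∩ ((fun x => x + s) '' (Set.univ \ (C₀ ∪ {0})))).ncard = m ^ 2 + m - 1 := by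
      rintro s ⟨h, h'⟩
      have := val2 s
      rw [h, h'] at this
      zify [(by omega : 1 ≤ m ^ 2 + m)]; push_cast at this; linarith
    have tr3 : ∀ s, P s = -1 ∧ r s = 0 → (D₀ ∩ ((fun x => x + s) '' C₀)).ncard +
            (D₁ ∩ ((fun x => x + s) '' (Set.univ \ (C₀ ∪ {0})))).ncard = m ^ 2 + m := by
      rintro s ⟨h, h'⟩
      have := val2 s
      rw [h, h'] at this
      zify; push_cast at this; linarith
    have tr4 : ∀ s, P s = 0 ∧ r s = -1 → (D₀ ∩ ((fun x => x + s) '' C₀)).ncard +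
            (D₁ ∩ ((fun x => x + s) '' (Set.univ \ (C₀ ∪ {0})))).ncard = m ^ 2 := by
      rintro s ⟨h, h'⟩
      have := val2 s
      rw [h, h'] at this
      zify; push_cast at this; linarith
    ext n
    simp only [Set.mem_range, Set.mem_insert_iff, Set.mem_singleton_iff]
    constructor
    · rintro ⟨s, rfl⟩
      rcases hPr s with h | h | h | h
      · left; exact tr1 s h
      · right; right; left; exact tr2 s h
      · right; right; right; exact tr3 s h
      · right; left; exact tr4 s h
    · rintro (rfl | rfl | rfl | rfl)
      · obtain ⟨s, h⟩ := ex1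
        exact ⟨s, tr1 s h⟩
      · obtain ⟨s, h⟩ := ex3
        exact ⟨s, tr4 s h⟩
      · by_cases hm1 : m = 1
        · obtain ⟨s, h⟩ := ex3
          refine ⟨s, ?_⟩
          have := tr4 s h
          rw [this, hm1]; norm_num
        · obtain ⟨s, h⟩ := ex4 hm1
          exact ⟨s, tr2 s h⟩
      · obtain ⟨s, h⟩ := ex2
        exact ⟨s, tr3 s h⟩

lemma decomp_sum {F F2 : Type} [Field F] [Fintype F] [Field F2] [Fintype F2] [Algebra F F2]
    (hc : Fintype.card F2 = Fintype.card F ^ 2) (β : F2) (hβ : ∀ c : F, algebraMap F F2 c ≠ β)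
    (f : F2 → ℂ) (hf : f 0 = 0) :
    ∑ y, f y = ∑ b : F, f (algebraMap F F2 b * β) +
      ∑ x : F, ∑ a : F, f (algebraMap F F2 a * (1 + algebraMap F F2 x * β)) := by
  have hinj : Function.Injective
      (fun p : F × F => algebraMap F F2 p.1 + algebraMap F F2 p.2 * β) := by
    rintro ⟨a, b⟩ ⟨c, d⟩ h
    simp only at h
    by_cases hbd : b = d
    · subst hbd
      have := (algebraMap F F2).injective (add_right_cancel h)
      rw [this]
    · exfalso
      have hne : algebraMap F F2 (d - b) ≠ 0 := by
        rw [Ne, map_eq_zero]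
        exact sub_ne_zero.2 (Ne.symm hbd)
      apply hβ ((a - c) / (d - b))
      rw [map_div₀, div_eq_iff hne, map_sub, map_sub]
      linear_combination h
  have hbij := (Fintype.bijective_iff_injective_and_card _).2
    ⟨hinj, by rw [Fintype.card_prod, hc, sq]⟩
  rw [← hbij.sum_comp f, Fintype.sum_prod_type, Finset.sum_comm' (t' := Finset.univ)
    (s' := fun _ => Finset.univ) (by simp)]
  rw [Finset.sum_comm]
  rw [Finset.sum_comm (f := fun x a => f (algebraMap F F2 a * (1 + algebraMap F F2 x * β)))]
  rw [← Finset.add_sum_erase _ _ (Finset.mem_univ (0 : F)),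
    ← Finset.add_sum_erase (a := (0 : F)) (s := Finset.univ)
      (f := fun a => ∑ x, f (algebraMap F F2 a * (1 + algebraMap F F2 x * β)))
      (Finset.mem_univ (0 : F))]
  simp only [map_zero, zero_add, zero_mul, hf, Finset.sum_const_zero]
  congr 1
  refine Finset.sum_congr rfl fun a ha => ?_
  have ha0 : a ≠ 0 := by simpa using ha
  rw [← (mulLeft_bijective₀ a ha0).sum_comp]
  refine Finset.sum_congr rfl fun x _ => ?_
  congr 1
  rw [map_mul]; ring

lemma gauss_shift {F : Type} [Field F] [Fintype F] (hF : ringChar F ≠ 2) (ψ : AddChar F ℂ) (t : F) :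
    ∑ a, (quadraticChar F a : ℂ) * ψ (a * t) =
      (quadraticChar F t : ℂ) * ∑ a, (quadraticChar F a : ℂ) * ψ a := by
  by_cases ht : t = 0
  · subst ht
    simp only [mul_zero, AddChar.map_zero_eq_one, mul_one, MulChar.map_zero, Int.cast_zero,
      zero_mul]
    exact_mod_cast quadraticChar_sum_zero hF
  · rw [← (mulRight_bijective₀ t ht).sum_comp (fun a => (quadraticChar F a : ℂ) * ψ a),
      Finset.mul_sum]
    refine Finset.sum_congr rfl fun a _ => ?_
    have : ((quadraticChar F t : ℤ) : ℂ) ^ 2 = 1 := by exact_mod_cast quadraticChar_sq_one ht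
    simp only [map_mul, Int.cast_mul]
    linear_combination (-(quadraticChar F a : ℂ) * ψ (a * t)) * this

lemma gauss_main {F F2 : Type} [Field F] [Fintype F] [Field F2] [Fintype F2] [Algebra F F2]
    (hc : Fintype.card F2 = Fintype.card F ^ 2) (hF : ringChar F ≠ 2)
    (β : F2) (hβ : ∀ c : F, algebraMap F F2 c ≠ β)
    (ψ : AddChar F ℂ) (χ : MulChar F2 ℂ)
    (hχ : ∀ a : F, χ (algebraMap F F2 a) = (quadraticChar F a : ℂ))
    (tr : F2 → F) (htrl : ∀ (a : F) (y : F2), tr (algebraMap F F2 a * y) = a * tr y)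
    (htra : ∀ y z, tr (y + z) = tr y + tr z)
    (γ : F2) (hγ : γ ≠ 0) :
    ∑ y, χ y * ψ (tr y) = χ γ * (∑ a, (quadraticChar F a : ℂ) * ψ a) *
      (χ β * (quadraticChar F (tr (γ * β)) : ℂ) +
        ∑ x, χ (1 + algebraMap F F2 x * β) * (quadraticChar F (tr γ + x * tr (γ * β)) : ℂ)) := by
  rw [← (mulLeft_bijective₀ γ hγ).sum_comp (fun y => χ y * ψ (tr y)),
    decomp_sum hc β hβ _ (by simp [MulChar.map_zero χ])]
  have e1 : ∀ b : F, χ (γ * (algebraMap F F2 b * β)) * ψ (tr (γ * (algebraMap F F2 b * β))) =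
      χ γ * χ β * ((quadraticChar F b : ℂ) * ψ (b * tr (γ * β))) := by
    intro b
    rw [show γ * (algebraMap F F2 b * β) = algebraMap F F2 b * (γ * β) by ring, htrl, map_mul,
      map_mul, hχ]
    ring
  have e2 : ∀ x a : F, χ (γ * (algebraMap F F2 a * (1 + algebraMap F F2 x * β))) *
      ψ (tr (γ * (algebraMap F F2 a * (1 + algebraMap F F2 x * β)))) =
      χ γ * χ (1 + algebraMap F F2 x * β) * ((quadraticChar F a : ℂ) *
        ψ (a * (tr γ + x * tr (γ * β)))) := by
    intro x a
    rw [show tr (γ * (algebraMap F F2 a * (1 + algebraMap F F2 x * β))) =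
      a * (tr γ + x * tr (γ * β)) by
        rw [← htrl x, ← htra, ← htrl a]; congr 1; ring]
    rw [map_mul, map_mul, hχ]
    ring
  simp only [e1, e2, ← Finset.mul_sum, gauss_shift hF]
  generalize (∑ a, (quadraticChar F a : ℂ) * ψ a) = g
  rw [mul_add, Finset.mul_sum]
  congr 1
  · ring
  · refine Finset.sum_congr rfl fun x _ => ?_
    ring

lemma sq_sum {F F2 : Type} [Field F] [Fintype F] [Field F2] [Fintype F2] [Algebra F F2]
    (hc : Fintype.card F2 = Fintype.card F ^ 2)
    (β : F2) (hβ : ∀ c : F, algebraMap F F2 c ≠ β) (χ : MulChar F2 ℂ) (hne : χ ^ 2 ≠ 1)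
    (hχ : ∀ a : F, χ (algebraMap F F2 a) = (quadraticChar F a : ℂ)) :
    ∑ x, χ (1 + algebraMap F F2 x * β) ^ 2 = - χ β ^ 2 := by
  have h0 := MulChar.sum_eq_zero_of_ne_one hne
  simp only [MulChar.pow_apply' χ two_ne_zero] at h0
  rw [decomp_sum hc β hβ _ (by simp [MulChar.map_zero χ])] at h0
  simp only [map_mul, hχ, mul_pow] at h0
  simp only [← Finset.sum_mul] at h0
  rw [← Finset.mul_sum, ← mul_add] at h0
  rcases mul_eq_zero.1 h0 with h | h
  · exfalso
    have h' : ∑ i : F, (quadraticChar F i) ^ 2 = 0 := by exact_mod_cast h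
    rw [Finset.sum_eq_zero_iff_of_nonneg (fun _ _ => sq_nonneg _)] at h'
    simpa using h' 1 (Finset.mem_univ _)
  · linear_combination h

/-- the four-intersection sets of Theorem 5.4 of the paper (`m` odd). -/
theorem stmt_15 (m q : ℕ) (hm : 0 < m) (hmodd : Odd m)
    (hq : q = 2 * m ^ 2 + 2 * m + 1) (hqpp : IsPrimePow q)
    (F F2 : Type) [Field F] [Fintype F] [Field F2] [Fintype F2] [Algebra F F2]
    (hF : Fintype.card F = q) (hF2 : Fintype.card F2 = q ^ 2)
    (ω : F2ˣ) (hω : ∀ x : F2ˣ, x ∈ Subgroup.zpowers ω)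
    (ψ : AddChar F ℂ) (hψ : ∃ a, ψ a ≠ 1)
    (tr : F2 → F) (htr : ∀ x : F2, algebraMap F F2 (tr x) = x + x ^ q)
    (χ : MulChar F2 ℂ) (hχω : χ (ω : F2) = Complex.I)
    (ε δ : ℤ) (hε : ε = 1 ∨ ε = -1) (hδ : δ = 1 ∨ δ = -1)
    (hGauss : (∑ x : F, quadChar F x * ψ x) * (∑ y : F2, χ y * ψ (tr y)) / q =
      (ε : ℂ) * m + (δ : ℂ) * (m + 1) * Complex.I)
    (h : ℤ) (hh : h = 0 ∨ h = 1 ∨ h = 2 ∨ h = 3)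
    (ℓ : ℤ)
    (hχℓ : χ ((ω ^ ℓ : F2ˣ) : F2) = Complex.I ^ (3 + h))
    (hχd : χ (((ω ^ (ℓ * (q : ℤ)) : F2ˣ) : F2) - ((ω ^ ℓ : F2ˣ) : F2)) =
      Complex.I ^ (δ * (1 + 2 * h)))
    (H₀ H₁ : Finset ℤ)
    (hH1 : ε * δ = 1 → H₀ = ({h, h + 1} : Finset ℤ) ∧ H₁ = ({h + 1, h + 2} : Finset ℤ))
    (hH2 : ε * δ = -1 → H₀ = ({h + 1, h + 2} : Finset ℤ) ∧ H₁ = ({h, h + 1} : Finset ℤ))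
    (C₀ : Set F) (hC₀ : C₀ = {x : F | x ≠ 0 ∧ IsSquare x})
    (D₀ D₁ : Set F)
    (hD₀ : D₀ = {x : F | ∃ j ∈ H₀,
      (1 + algebraMap F F2 x * ((ω ^ ℓ : F2ˣ) : F2)) ∈ cyc ω 4 j})
    (hD₁ : D₁ = {x : F | ∃ j ∈ H₁,
      (1 + algebraMap F F2 x * ((ω ^ ℓ : F2ˣ) : F2)) ∈ cyc ω 4 j}) :
    D₀.ncard = m ^ 2 ∧ D₁.ncard = m ^ 2 + m ∧
      (Set.range fun s : F =>
          (D₀ ∩ ((fun x => x + s) '' (C₀ ∪ {0}))).ncard +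
            (D₁ ∩ ((fun x => x + s) '' C₀)).ncard) =
        ({m ^ 2, m ^ 2 + m + 1} : Set ℕ) ∧
      (Set.range fun s : F =>
          (D₀ ∩ ((fun x => x + s) '' C₀)).ncard +
            (D₁ ∩ ((fun x => x + s) '' (Set.univ \ (C₀ ∪ {0})))).ncard) =
        ({m ^ 2 - 1, m ^ 2, m ^ 2 + m - 1, m ^ 2 + m} : Set ℕ) := by
  have hq4 : ∃ k, q = 4 * k + 1 := by
    obtain ⟨k, rfl⟩ := hmodd
    exact ⟨2 * k ^ 2 + 3 * k + 1, by rw [hq]; ring⟩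
  obtain ⟨k, hk⟩ := hq4
  have hI4 : (I : ℂ) ^ 4 = 1 := Complex.I_pow_four
  have hc : Fintype.card F2 = Fintype.card F ^ 2 := by rw [hF2, hF]
  have hchar : ringChar F ≠ 2 := by
    intro h2
    have := FiniteField.even_card_iff_char_two.1 h2
    omega
  have h2F : (2 : F) ≠ 0 := Ring.two_ne_zero hchar
  have h2F2 : (2 : F2) ≠ 0 := by
    rw [← map_ofNat (algebraMap F F2) 2]
    simpa using h2F
  -- powers of ω
  have hχpow : ∀ n : ℤ, χ ((ω ^ n : F2ˣ) : F2) = I ^ n := by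
    intro n
    rw [← MulChar.coe_toUnitHom, map_zpow, Units.val_zpow_eq_zpow_val, MulChar.coe_toUnitHom, hχω]
  have hlog : ∀ z : F2, z ≠ 0 → ∃ n : ℤ, z = ((ω ^ n : F2ˣ) : F2) := by
    intro z hz
    obtain ⟨n, hn⟩ := Subgroup.mem_zpowers_iff.1 (hω (Units.mk0 z hz))
    exact ⟨n, by rw [hn]; rfl⟩
  have hχ4 : ∀ z : F2, z ≠ 0 → χ z ^ 4 = 1 := by
    intro z hz
    obtain ⟨n, rfl⟩ := hlog z hz
    rw [hχpow, ← zpow_natCast, ← zpow_mul, mul_comm, zpow_mul]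
    norm_num [hI4]
  have hχq : ∀ z : F2, z ≠ 0 → χ (z ^ q) = χ z := by
    intro z hz
    rw [map_pow, hk, pow_succ, pow_mul, hχ4 z hz, one_pow, one_mul]
  have hprim : IsPrimitiveRoot (I : ℂ) 4 := Complex.isPrimitiveRoot_I
  have hcyc : ∀ (z : F2) (j : ℤ), z ≠ 0 → (z ∈ cyc ω 4 j ↔ χ z = I ^ j) := by
    intro z j hz
    constructor
    · rintro ⟨k, rfl⟩
      rw [hχpow, zpow_add₀ I_ne_zero, zpow_mul]
      norm_num [hI4]
    · obtain ⟨n, rfl⟩ := hlog z hz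
      intro hn
      rw [hχpow] at hn
      have : (I : ℂ) ^ (n - j) = 1 := by
        rw [zpow_sub₀ I_ne_zero, hn, div_self (zpow_ne_zero _ I_ne_zero)]
      rw [hprim.zpow_eq_one_iff_dvd] at this
      obtain ⟨k, hk⟩ := this
      exact ⟨k, by rw [← hk]; congr 2; ring⟩
  -- Frobenius
  have hadd : ∀ y z : F2, (y + z) ^ q = y ^ q + z ^ q := by
    intro y z
    have := map_add (FiniteField.frobeniusAlgHom F F2) y z
    simpa [hF] using this
  have hfix : ∀ a : F, algebraMap F F2 a ^ q = algebraMap F F2 a := by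
    intro a
    rw [← map_pow, ← hF, FiniteField.pow_card]
  have hinv : ∀ z : F2, (z ^ q) ^ q = z := by
    intro z
    rw [← pow_mul, ← sq, ← hF2, FiniteField.pow_card]
  have halg := (algebraMap F F2).injective
  have htra : ∀ y z, tr (y + z) = tr y + tr z := by
    intro y z
    apply halg
    rw [map_add, htr, htr, htr, hadd]; ring
  have htrl : ∀ (a : F) (y : F2), tr (algebraMap F F2 a * y) = a * tr y := by
    intro a y
    apply halg
    rw [map_mul, htr, htr, mul_pow, hfix]; ring
  -- restriction of χ
  have hχη : ∀ a : F, χ (algebraMap F F2 a) = (quadraticChar F a : ℂ) := by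
    have hsqr : ∀ a : F, quadraticChar F a = 1 → χ (algebraMap F F2 a) = 1 := by
      intro a ha
      have ha0 : a ≠ 0 := by rintro rfl; simp at ha
      obtain ⟨b, rfl⟩ := (quadraticChar_one_iff_isSquare ha0).1 ha
      have hb0 : b ≠ 0 := by rintro rfl; simp at ha0
      have hb0' : algebraMap F F2 b ≠ 0 := by simpa using hb0
      obtain ⟨n, hn⟩ := hlog _ hb0'
      have h1 : (ω ^ (n * (q - 1 : ℤ))) = (1 : F2ˣ) := by
        have e : (ω ^ n) ^ q = ω ^ n := by
          ext
          rw [Units.val_pow_eq_pow_val, ← hn, hfix]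
        rw [zpow_mul, zpow_sub, zpow_natCast, e]; simp
      rw [← orderOf_dvd_iff_zpow_eq_one, orderOf_eq_card_of_forall_mem_zpowers hω,
        Nat.card_eq_fintype_card, Fintype.card_units, hF2] at h1
      have hq1 : ((q ^ 2 - 1 : ℕ) : ℤ) = (q + 1) * (q - 1) := by
        rw [Nat.cast_sub (Nat.one_le_pow _ _ (by omega))]; push_cast; ring
      rw [hq1] at h1
      have h2 : ((q : ℤ) + 1) ∣ n := by
        refine Int.dvd_of_mul_dvd_mul_right (a := (q : ℤ) - 1) ?_ h1
        have : 1 < q := by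
          rw [← hF]; exact Fintype.one_lt_card
        omega
      obtain ⟨t, ht⟩ := h2
      rw [map_mul, map_mul, hn, hχpow, ht, ← zpow_add₀ I_ne_zero,
        hprim.zpow_eq_one_iff_dvd]
      exact ⟨(2 * k + 1) * t, by rw [hk]; push_cast; ring⟩
    set c : F := (tr ω ^ 2 - tr (ω ^ 2)) / 2 with hcdef
    have hcv : algebraMap F F2 c = (ω : F2) ^ (q + 1) := by
      rw [hcdef, map_div₀, map_sub, map_pow, htr, htr, map_ofNat, div_eq_iff h2F2]
      ring
    have hχc : χ (algebraMap F F2 c) = -1 := by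
      rw [hcv, map_pow, hχω, hk, show 4 * k + 1 + 1 = 4 * k + 2 by ring, pow_add, pow_mul, hI4]
      simp
    have hc0 : c ≠ 0 := by
      intro h0
      rw [h0, map_zero, MulChar.map_zero] at hχc
      norm_num at hχc
    have hηc : quadraticChar F c = -1 := by
      rcases quadraticChar_dichotomy hc0 with h1 | h1
      · rw [hsqr c h1] at hχc; norm_num at hχc
      · exact h1
    intro a
    by_cases ha : a = 0
    · subst ha; simp [MulChar.map_zero χ]
    · rcases quadraticChar_dichotomy ha with h1 | h1
      · rw [hsqr a h1, h1]; simp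
      · have h2 : quadraticChar F (a * c) = 1 := by rw [map_mul, h1, hηc]; norm_num
        have h3 := hsqr _ h2
        rw [map_mul, map_mul, hχc] at h3
        rw [h1]; push_cast
        linear_combination -h3
  have hneg : χ (-1) = 1 := by
    rw [show (-1 : F2) = algebraMap F F2 (-1) by simp, hχη]
    have : quadraticChar F (-1) = 1 := by
      rw [quadraticChar_one_iff_isSquare (by simp), FiniteField.isSquare_neg_one_iff, hF]
      omega
    rw [this]; simp
  -- the Gauss sum over F
  have hquad : ∀ x, quadChar F x = (quadraticChar F x : ℂ) := by
    intro x
    rw [quadraticChar_apply]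
    unfold quadChar quadraticCharFun
    split_ifs <;> simp
  have hg : (∑ a, (quadraticChar F a : ℂ) * ψ a) ^ 2 = q := by
    have hψ1 : ψ ≠ 1 := by
      rintro rfl
      obtain ⟨a, ha⟩ := hψ
      exact ha rfl
    have hne : (quadraticChar F).ringHomComp (Int.castRingHom ℂ) ≠ 1 :=
      (MulChar.ringHomComp_ne_one_iff (RingHom.injective_int _)).2 (quadraticChar_ne_one hchar)
    have := gaussSum_sq hne ((quadraticChar_isQuadratic F).comp _)
      (AddChar.IsPrimitive.of_ne_one hψ1)
    have h1 : quadraticChar F (-1) = 1 := by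
      rw [quadraticChar_one_iff_isSquare (by simp), FiniteField.isSquare_neg_one_iff, hF]
      omega
    simpa [gaussSum, h1, hF] using this
  have hq0 : (q : ℂ) ≠ 0 := by
    have : q ≠ 0 := by omega
    exact_mod_cast this
  simp only [hquad] at hGauss
  -- β and θ
  have hβq : ((ω ^ (ℓ * (q : ℤ)) : F2ˣ) : F2) = ((ω ^ ℓ : F2ˣ) : F2) ^ q := by
    rw [zpow_mul, zpow_natCast, Units.val_pow_eq_pow_val]
  rw [hβq] at hχd
  have hβ0 : ((ω ^ ℓ : F2ˣ) : F2) ≠ 0 := Units.ne_zero _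
  generalize ((ω ^ ℓ : F2ˣ) : F2) = β at *
  have hθ0 : β ^ q - β ≠ 0 := by
    intro h0
    rw [h0, MulChar.map_zero] at hχd
    exact zpow_ne_zero _ I_ne_zero hχd.symm
  have hβF : ∀ c : F, algebraMap F F2 c ≠ β := by
    rintro c rfl
    exact hθ0 (by rw [hfix, sub_self])
  have hz0 : ∀ x : F, 1 + algebraMap F F2 x * β ≠ 0 := by
    intro x hx
    by_cases hx0 : x = 0
    · simp [hx0] at hx
    · have hx1 : algebraMap F F2 x ≠ 0 := by simpa using hx0
      apply hβF (-1 / x)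
      rw [map_div₀, div_eq_iff hx1, map_neg, map_one]
      linear_combination -hx
  set θ := β ^ q - β with hθ
  have hθq : θ ^ q = -θ := by
    have h1 : θ + β = β ^ q := by rw [hθ]; ring
    have h2 := hadd θ β
    rw [h1, hinv] at h2
    rw [hθ]; linear_combination -h2
  have hdivq : ∀ y z : F2, (y / z) ^ q = y ^ q / z ^ q := fun y z => div_pow _ _ _
  have hχθ4 := hχ4 θ hθ0
  have hχθ0 : χ θ ≠ 0 := fun h0 => by rw [h0] at hχθ4; norm_num at hχθ4
  have hdivχ : ∀ y : F2, χ (y / θ) * χ θ = χ y := by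
    intro y; rw [← map_mul, div_mul_cancel₀ _ hθ0]
  set W : ℂ := (ε : ℂ) * m + (δ : ℂ) * (m + 1) * I with hW
  have hmain : ∀ γ : F2, γ ≠ 0 → W = χ γ * (χ β * (quadraticChar F (tr (γ * β)) : ℂ) +
        ∑ x, χ (1 + algebraMap F F2 x * β) * (quadraticChar F (tr γ + x * tr (γ * β)) : ℂ)) := by
    intro γ hγ
    rw [← hGauss, gauss_main hc hchar β hβF ψ χ hχη tr htrl htra γ hγ, div_eq_iff hq0, ← hg]
    ring
  have hA : W * χ θ = χ β * ∑ x, χ (1 + algebraMap F F2 x * β) := by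
    have hγ : β ^ q / θ ≠ 0 := div_ne_zero (pow_ne_zero _ hβ0) hθ0
    have t1 : tr (β ^ q / θ) = 1 := by
      apply halg
      rw [htr, hdivq, hinv, hθq, map_one, div_neg, ← sub_eq_add_neg, ← sub_div]
      exact div_self hθ0
    have t2 : tr (β ^ q / θ * β) = 0 := by
      apply halg
      rw [htr, mul_pow, hdivq, hinv, hθq, map_zero, div_neg]
      ring
    have := hmain _ hγ
    simp only [t1, t2, mul_zero, add_zero, map_one, MulChar.map_zero, Int.cast_zero, Int.cast_one,
      mul_one, zero_add] at this
    rw [this, ← hχq β hβ0, ← hdivχ (β ^ q)]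
    ring
  have hB : ∀ s, W * χ θ = χ (1 + algebraMap F F2 s * β) * (χ β +
      ∑ x, χ (1 + algebraMap F F2 x * β) * (quadraticChar F (x - s) : ℂ)) := by
    intro s
    have hzq : (1 + algebraMap F F2 s * β) ^ q = 1 + algebraMap F F2 s * β ^ q := by
      rw [hadd, mul_pow, hfix, one_pow]
    have hzq' : (1 + algebraMap F F2 s * β ^ q) ^ q = 1 + algebraMap F F2 s * β := by
      rw [← hzq, hinv]
    have hz1 : 1 + algebraMap F F2 s * β ^ q ≠ 0 := by
      rw [← hzq]; exact pow_ne_zero _ (hz0 s)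
    have hqodd : Odd q := ⟨2 * k, by omega⟩
    set γ := -(1 + algebraMap F F2 s * β ^ q) / θ with hγd
    have hγ : γ ≠ 0 := div_ne_zero (neg_ne_zero.2 hz1) hθ0
    have hγq : γ ^ q = (1 + algebraMap F F2 s * β) / θ := by
      rw [hγd, hdivq, hqodd.neg_pow, hzq', hθq, neg_div_neg_eq]
    have t1 : tr γ = -s := by
      apply halg
      rw [htr, hγq, hγd, ← add_div, div_eq_iff hθ0, map_neg, hθ]
      ring
    have t2 : tr (γ * β) = 1 := by
      apply halg
      rw [htr, mul_pow, hγq, hγd, div_mul_eq_mul_div, div_mul_eq_mul_div, ← add_div,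
        div_eq_iff hθ0, map_one, hθ]
      ring
    have := hmain _ hγ
    simp only [t1, t2, mul_one, map_one, Int.cast_one] at this
    have e : χ γ * χ θ = χ (1 + algebraMap F F2 s * β) := by
      rw [hγd, hdivχ, ← hχq _ (hz0 s), hzq, neg_eq_neg_one_mul, map_mul, hneg, one_mul]
    rw [this, ← e]
    simp only [neg_add_eq_sub]
    ring
  have hne2 : χ ^ 2 ≠ 1 := by
    intro h0
    have := congrArg (fun c : MulChar F2 ℂ => c (ω : F2)) h0
    simp [MulChar.pow_apply' χ two_ne_zero, hχω, MulChar.one_apply_coe] at this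
    norm_num at this
  have hC := sq_sum hc β hβF χ hne2 hχη
  obtain ⟨v, hv⟩ : ∃ v : ℂ, v = I ^ h := ⟨_, rfl⟩
  have hv4 : v ^ 4 = 1 := by
    rw [hv, ← zpow_natCast, ← zpow_mul, mul_comm, zpow_mul]
    norm_num [hI4]
  have hv0 : v ≠ 0 := fun h0 => by rw [h0] at hv4; norm_num at hv4
  have hI3 : (I : ℂ) ^ (3 : ℤ) = -I := by
    rw [show (3 : ℤ) = ((3 : ℕ) : ℤ) by rfl, zpow_natCast, Complex.I_pow_three]
  have hχβ : χ β = -I * v := by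
    rw [hχℓ, zpow_add₀ I_ne_zero, hI3, hv]
  have hv2 : (I : ℂ) ^ (1 + 2 * h) = I * v ^ 2 := by
    rw [zpow_add₀ I_ne_zero, zpow_one, mul_comm 2 h, zpow_mul, hv]
    norm_cast
  have hχθ : χ θ = δ * I * v ^ 2 := by
    rw [hχd]
    rcases hδ with rfl | rfl
    · rw [one_mul, hv2]; push_cast; ring
    · rw [neg_one_mul, zpow_neg, hv2]
      rw [inv_eq_iff_eq_inv]
      apply eq_inv_of_mul_eq_one_left
      push_cast
      linear_combination (-v ^ 4) * Complex.I_sq + hv4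
  have hU : ∀ x : F, ∃ p r : ℤ, χ (1 + algebraMap F F2 x * β) = (p + r * I) * v ∧
      ((p = 1 ∧ r = 0) ∨ (p = 0 ∧ r = 1) ∨ (p = -1 ∧ r = 0) ∨ (p = 0 ∧ r = -1)) := by
    intro x
    have h4 := hχ4 _ (hz0 x)
    set z := χ (1 + algebraMap F F2 x * β)
    have : (z - v) * (z - I * v) * (z + v) * (z + I * v) = 0 := by
      linear_combination h4 - hv4 + (v ^ 2 * (v ^ 2 - z ^ 2)) * Complex.I_sq
    rcases mul_eq_zero.1 this with h1 | h1
    · rcases mul_eq_zero.1 h1 with h1 | h1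
      · rcases mul_eq_zero.1 h1 with h1 | h1
        · exact ⟨1, 0, by push_cast; linear_combination h1, by simp⟩
        · exact ⟨0, 1, by push_cast; linear_combination h1, by simp⟩
      · exact ⟨-1, 0, by push_cast; linear_combination h1, by simp⟩
    · exact ⟨0, -1, by push_cast; linear_combination h1, by simp⟩
  choose p r hpr hcases using hU
  have hδ2 : (δ : ℂ) * δ = 1 := by rcases hδ with rfl | rfl <;> norm_num
  have hδ2Z : δ * δ = 1 := by rcases hδ with rfl | rfl <;> norm_num
  have hε2Z : ε * ε = 1 := by rcases hε with rfl | rfl <;> norm_num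
  -- sum of values
  have hS1 : ((∑ x, p x : ℤ) : ℂ) + ((∑ x, r x : ℤ) : ℂ) * I = -δ * W := by
    simp only [hpr] at hA
    rw [← Finset.sum_mul, Finset.sum_add_distrib, ← Finset.sum_mul, hχθ, hχβ] at hA
    have h1 : (I * v ^ 2) ≠ 0 := mul_ne_zero I_ne_zero (pow_ne_zero _ hv0)
    apply mul_left_cancel₀ h1
    push_cast
    linear_combination hA
  have hS2 : ∑ x, (p x ^ 2 - r x ^ 2) = 1 := by
    simp only [hpr] at hC
    have e : ∀ x, (((p x : ℂ) + r x * I) * v) ^ 2 = ((p x ^ 2 - r x ^ 2 : ℤ) : ℂ) * v ^ 2 := by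
      intro x
      have : (p x : ℂ) * r x = 0 := by
        rcases hcases x with ⟨a, b⟩ | ⟨a, b⟩ | ⟨a, b⟩ | ⟨a, b⟩ <;> simp [a, b]
      push_cast
      linear_combination (2 * I * v ^ 2) * this + (r x : ℂ) ^ 2 * v ^ 2 * Complex.I_sq
    simp only [e] at hC
    rw [← Finset.sum_mul, hχβ] at hC
    have : ((∑ x, (p x ^ 2 - r x ^ 2) : ℤ) : ℂ) = 1 := by
      apply mul_right_cancel₀ (pow_ne_zero 2 hv0)
      rw [Int.cast_sum]
      linear_combination hC - v ^ 2 * Complex.I_sq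
    exact_mod_cast this
  have hS3 : ∀ s, ((∑ x, quadraticChar F (x - s) * p x : ℤ) : ℂ) +
      ((∑ x, quadraticChar F (x - s) * r x : ℤ) : ℂ) * I =
      I + δ * I * W * (p s - r s * I) := by
    intro s
    have hBs := hB s
    have e : ∑ x, χ (1 + algebraMap F F2 x * β) * (quadraticChar F (x - s) : ℂ) =
        (((∑ x, quadraticChar F (x - s) * p x : ℤ) : ℂ) +
          ((∑ x, quadraticChar F (x - s) * r x : ℤ) : ℂ) * I) * v := by
      push_cast
      rw [Finset.sum_mul, ← Finset.sum_add_distrib, Finset.sum_mul]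
      refine Finset.sum_congr rfl fun x _ => ?_
      rw [hpr]; ring
    rw [e, hpr, hχθ, hχβ] at hBs
    have hu : ((p s : ℂ) + r s * I) * (p s - r s * I) = 1 := by
      have h1 : (p s : ℂ) ^ 2 + (r s : ℂ) ^ 2 = 1 := by
        rcases hcases s with ⟨a, b⟩ | ⟨a, b⟩ | ⟨a, b⟩ | ⟨a, b⟩ <;> simp [a, b]
      linear_combination h1 - (r s : ℂ) ^ 2 * Complex.I_sq
    generalize ((∑ x, quadraticChar F (x - s) * p x : ℤ) : ℂ) +
      ((∑ x, quadraticChar F (x - s) * r x : ℤ) : ℂ) * I = T at *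
    apply mul_right_cancel₀ (pow_ne_zero 2 hv0)
    linear_combination (-(p s : ℂ) + r s * I) * hBs + (-T * v ^ 2 + I * v ^ 2) * hu
  have hext : ∀ a b c d : ℤ, (a : ℂ) + b * I = c + d * I → a = c ∧ b = d := by
    intro a b c d h0
    constructor
    · have := congrArg Complex.re h0
      simp at this
      exact_mod_cast this
    · have := congrArg Complex.im h0
      simp at this
      exact_mod_cast this
  have hT1 := hext _ _ (-(ε * δ) * m) (-(m + 1)) (by
    rw [hS1, hW]; push_cast
    linear_combination (-(m + 1 : ℂ) * I) * hδ2)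
  have hT3 := fun s => hext _ _ (ε * δ * m * r s - (m + 1) * p s)
      (1 + ε * δ * m * p s + (m + 1) * r s) (by
    rw [hS3 s, hW]; push_cast
    linear_combination ((m + 1 : ℂ) * I ^ 2 * (p s - r s * I)) * hδ2 +
      (-(ε : ℂ) * δ * m * r s + (m + 1) * p s - (m + 1) * r s * I) * Complex.I_sq)
  have hIh1 : (I : ℂ) ^ (h + 1) = I * v := by
    rw [zpow_add₀ I_ne_zero, zpow_one, hv, mul_comm]
  have hIh2 : (I : ℂ) ^ (h + 2) = -1 * v := by
    rw [zpow_add₀ I_ne_zero, hv, mul_comm]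
    norm_cast
    rw [Complex.I_sq]; push_cast; rfl
  have hm0 : ∀ x, 1 + algebraMap F F2 x * β ∈ cyc ω 4 h ↔ (p x = 1 ∧ r x = 0) := by
    intro x
    rw [hcyc _ _ (hz0 x), hpr, ← hv]
    constructor
    · intro h0
      refine hext _ _ 1 0 (mul_right_cancel₀ hv0 ?_)
      rw [h0]; push_cast; ring
    · rintro ⟨a, b⟩; rw [a, b]; push_cast; ring
  have hm1 : ∀ x, 1 + algebraMap F F2 x * β ∈ cyc ω 4 (h + 1) ↔ (p x = 0 ∧ r x = 1) := by
    intro x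
    rw [hcyc _ _ (hz0 x), hpr, hIh1]
    constructor
    · intro h0
      refine hext _ _ 0 1 (mul_right_cancel₀ hv0 ?_)
      rw [h0]; push_cast; ring
    · rintro ⟨a, b⟩; rw [a, b]; push_cast; ring
  have hm2 : ∀ x, 1 + algebraMap F F2 x * β ∈ cyc ω 4 (h + 2) ↔ (p x = -1 ∧ r x = 0) := by
    intro x
    rw [hcyc _ _ (hz0 x), hpr, hIh2]
    constructor
    · intro h0
      refine hext _ _ (-1) 0 (mul_right_cancel₀ hv0 ?_)
      rw [h0]; push_cast; ring
    · rintro ⟨a, b⟩; rw [a, b]; push_cast; ring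
  have hκ : ε * δ = 1 ∨ ε * δ = -1 := by
    rcases hε with rfl | rfl <;> rcases hδ with rfl | rfl <;> norm_num
  have hDD : (∀ x, x ∈ D₀ ↔ ε * δ * p x + r x = 1) ∧ (∀ x, x ∈ D₁ ↔ r x - ε * δ * p x = 1) := by
    rcases hκ with h1 | h1
    · obtain ⟨e0, e1⟩ := hH1 h1
      rw [hD₀, hD₁, e0, e1, h1]
      constructor <;> intro x <;>
        simp only [Set.mem_setOf_eq, Finset.mem_insert, Finset.mem_singleton, exists_eq_or_imp,
          exists_eq_left, hm0, hm1, hm2] <;>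
        rcases hcases x with ⟨a, b⟩ | ⟨a, b⟩ | ⟨a, b⟩ | ⟨a, b⟩ <;> rw [a, b] <;> norm_num
    · obtain ⟨e0, e1⟩ := hH2 h1
      rw [hD₀, hD₁, e0, e1, h1]
      constructor <;> intro x <;>
        simp only [Set.mem_setOf_eq, Finset.mem_insert, Finset.mem_singleton, exists_eq_or_imp,
          exists_eq_left, hm0, hm1, hm2] <;>
        rcases hcases x with ⟨a, b⟩ | ⟨a, b⟩ | ⟨a, b⟩ | ⟨a, b⟩ <;> rw [a, b] <;> norm_num
  have hκ2 : (ε * δ) * (ε * δ) = 1 := by rcases hκ with h1 | h1 <;> rw [h1] <;> norm_num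
  generalize ε * δ = κ at hκ hκ2 hDD hT1 hT3
  refine final_comb F m hm (fun x => κ * p x) r ?_ (hF.trans hq) hchar ?_ hT1.2 ?_ ?_ ?_ C₀ hC₀
    D₀ D₁ hDD.1 hDD.2
  · intro x
    rcases hκ with rfl | rfl <;>
      rcases hcases x with ⟨a, b⟩ | ⟨a, b⟩ | ⟨a, b⟩ | ⟨a, b⟩ <;> simp [a, b]
  · rw [← Finset.mul_sum, hT1.1]
    linear_combination (-(m : ℤ)) * hκ2
  · rw [← hS2]
    refine Finset.sum_congr rfl fun x _ => ?_
    linear_combination (p x ^ 2) * hκ2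
  · intro s
    have := (hT3 s).1
    simp only [mul_left_comm _ κ, ← Finset.mul_sum, this]
    linear_combination (m * r s) * hκ2
  · intro s
    rw [(hT3 s).2]; ring
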